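/- (Abstract reorg resilience.) Let T be a blocktree finset, p ∈ T, and W* a finite set of votes such that every greedy heaviest chain of (T, W*) ends at p. Let b ∉ T be a block with parent b = p such that no vote in W* is for a descendant of b, and set T' = T ∪ {b}. Let N be a natural number and for each slot s ∈ {0, …, N} let H_s and A_s be finite sets of votes such that no validator has a vote in both H_s and A_s, and the number of distinct validators with a vote in H_s is strictly greater than the number of distinct validators with a vote in A_s. Assume that every vote in H_0 is for the endpoint of some greedy heaviest chain of (T', W*), and that for every s with 1 ≤ s ≤ N and every vote (v, c) ∈ H_s there exists a finite set of votes W with H_{s−1} ⊆ W ⊆ H_{s−1} ∪ A_{s−1} and a greedy heaviest chain of (T', W) ending at c. Then for every s ∈ {0, …, N} and every finite set of votes W with H_s ⊆ W ⊆ H_s ∪ A_s, every greedy heaviest chain of (T', W) contains b. -/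

import Mathlib

/-- `a` is an ancestor of `b` (equivalently, `b` is a descendant of `a`):
`a = parent^[k] b` for some `k ≥ 0`. -/
def Ancestor {B : Type*} (parent : B → B) (a b : B) : Prop :=
  ∃ k : ℕ, a = parent^[k] b

/-- Blocks `a` and `b` conflict if neither is an ancestor of the other. -/
def Conflicting {B : Type*} (parent : B → B) (a b : B) : Prop :=
  ¬ Ancestor parent a b ∧ ¬ Ancestor parent b a

/-- A finset `T` of blocks is a blocktree finset if it contains the genesis `g`
and is closed under `parent`. -/
def IsBlocktree {B : Type*} (g : B) (parent : B → B) (T : Finset B) : Prop :=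
  g ∈ T ∧ ∀ x ∈ T, parent x ∈ T

/-- `c` is a child of `a` in `T`: `c ∈ T`, `c ≠ g`, and `parent c = a`. -/
def IsChild {B : Type*} (g : B) (parent : B → B) (T : Finset B) (a c : B) : Prop :=
  c ∈ T ∧ c ≠ g ∧ parent c = a

open Classical in
/-- The weight of block `a` w.r.t. the vote set `W`: the number of distinct
validators casting a vote in `W` for a descendant of `a`. -/
noncomputable def wt {B V : Type*} (parent : B → B) (W : Finset (V × B)) (a : B) : ℕ :=
  ((W.filter (fun q => Ancestor parent a q.2)).image Prod.fst).card

/-- `ch 0, ch 1, …, ch k` is a greedy heaviest chain of `(T, W)`: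
it starts at the genesis `g`, consists of blocks of `T`, each step goes to a
child of maximal weight, and the endpoint `ch k` has no children in `T`. -/
def IsGreedyChain {B V : Type*} (g : B) (parent : B → B) (T : Finset B)
    (W : Finset (V × B)) (k : ℕ) (ch : ℕ → B) : Prop :=
  ch 0 = g ∧ (∀ i ≤ k, ch i ∈ T) ∧
  (∀ i < k, IsChild g parent T (ch i) (ch (i + 1)) ∧
      ∀ c', IsChild g parent T (ch i) c' → wt parent W c' ≤ wt parent W (ch (i + 1))) ∧
  ∀ c', ¬ IsChild g parent T (ch k) c'

theorem Ancestor.refl {B : Type*} (parent : B → B) (a : B) : Ancestor parent a a :=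
  ⟨0, rfl⟩

theorem Ancestor.trans {B : Type*} {parent : B → B} {a b c : B}
    (hab : Ancestor parent a b) (hbc : Ancestor parent b c) : Ancestor parent a c := by
  obtain ⟨m, rfl⟩ := hab
  obtain ⟨n, rfl⟩ := hbc
  exact ⟨m + n, (Function.iterate_add_apply parent m n c).symm⟩

theorem Ancestor.parent_left {B : Type*} {parent : B → B} {a b : B}
    (h : Ancestor parent a b) : Ancestor parent (parent a) b := by
  obtain ⟨n, rfl⟩ := h
  exact ⟨n + 1, (Function.iterate_succ_apply' parent n b).symm⟩

theorem Ancestor.eq_or_parent {B : Type*} {parent : B → B} {a b : B}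
    (h : Ancestor parent a b) : a = b ∨ Ancestor parent a (parent b) := by
  obtain ⟨_ | n, rfl⟩ := h
  · exact Or.inl rfl
  · exact Or.inr ⟨n, rfl⟩

/-- Two ancestors of the same block are comparable. -/
theorem Ancestor.total_of_common {B : Type*} {parent : B → B} {a b c : B}
    (ha : Ancestor parent a c) (hb : Ancestor parent b c) :
    Ancestor parent a b ∨ Ancestor parent b a := by
  obtain ⟨m, rfl⟩ := ha
  obtain ⟨n, rfl⟩ := hb
  rcases le_total m n with h | h
  · refine Or.inr ⟨n - m, ?_⟩
    rw [← Function.iterate_add_apply, Nat.sub_add_cancel h]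
  · refine Or.inl ⟨m - n, ?_⟩
    rw [← Function.iterate_add_apply, Nat.sub_add_cancel h]

/-- If the parent map fixes `g` and `g` is an ancestor of every block,
then ancestry is antisymmetric. -/
theorem Ancestor.antisymm {B : Type*} {g : B} {parent : B → B} (hpg : parent g = g)
    (hanc : ∀ x, Ancestor parent g x) {a b : B}
    (hab : Ancestor parent a b) (hba : Ancestor parent b a) : a = b := by
  obtain ⟨m, rfl⟩ := hab
  obtain ⟨n, hn⟩ := hba
  rw [← Function.iterate_add_apply] at hn
  rcases Nat.eq_zero_or_pos m with rfl | hm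
  · rfl
  obtain ⟨r, hr⟩ := hanc b
  have hper : Function.IsPeriodicPt parent (n + m) b := hn.symm
  have hb : b = g := by
    have hfix : parent^[(n + m) * r] b = b := hper.mul_const r
    have hle : r ≤ (n + m) * r := Nat.le_mul_of_pos_left r (by omega)
    rw [← Nat.sub_add_cancel hle, Function.iterate_add_apply, ← hr,
      Function.iterate_fixed hpg] at hfix
    exact hfix.symm
  rw [hb, Function.iterate_fixed hpg]

theorem IsBlocktree.iterate_mem {B : Type*} {g : B} {parent : B → B} {T : Finset B}
    (hT : IsBlocktree g parent T) {b : B} (hb : b ∈ T) (n : ℕ) : parent^[n] b ∈ T := by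
  induction n with
  | zero => exact hb
  | succ n ih => rw [Function.iterate_succ_apply']; exact hT.2 _ ih

theorem IsBlocktree.insert {B : Type*} [DecidableEq B] {g : B} {parent : B → B} {T : Finset B}
    (hT : IsBlocktree g parent T) {b : B} (hb : parent b ∈ T) :
    IsBlocktree g parent (insert b T) := by
  refine ⟨Finset.mem_insert_of_mem hT.1, fun x hx => Finset.mem_insert_of_mem ?_⟩
  rcases Finset.mem_insert.1 hx with rfl | hx
  · exact hb
  · exact hT.2 x hx

/-- A proper ancestor of a block `b` of a blocktree has a child that is an ancestor of `b`. -/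
theorem Ancestor.exists_isChild {B : Type*} {g : B} {parent : B → B} {T : Finset B}
    (hpg : parent g = g) (hT : IsBlocktree g parent T) {a b : B} (hb : b ∈ T)
    (hab : Ancestor parent a b) (hne : a ≠ b) :
    ∃ c, IsChild g parent T a c ∧ Ancestor parent c b := by
  obtain ⟨n, hn⟩ := hab
  induction n with
  | zero => exact absurd hn hne
  | succ n ih =>
    by_cases hg : parent^[n] b = g
    · refine ih ?_
      rw [hn, Function.iterate_succ_apply', hg, hpg]
    · refine ⟨parent^[n] b, ⟨hT.iterate_mem hb n, hg, ?_⟩, n, rfl⟩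
      rw [hn, Function.iterate_succ_apply']

/-- Every block of a greedy heaviest chain is an ancestor of the endpoint. -/
theorem IsGreedyChain.ancestor_endpoint {B V : Type*} {g : B} {parent : B → B} {T : Finset B}
    {W : Finset (V × B)} {k : ℕ} {ch : ℕ → B} (h : IsGreedyChain g parent T W k ch)
    {i : ℕ} (hi : i ≤ k) : Ancestor parent (ch i) (ch k) := by
  induction hi using Nat.decreasingInduction with
  | self => exact Ancestor.refl parent _
  | of_succ i hi ih => exact (h.2.2.1 i hi).1.2.2 ▸ ih.parent_left

/-- If every greedy heaviest chain of `(T, W)` ends at the parent of a new block `b`,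
then every greedy heaviest chain of `(T ∪ {b}, W)` contains `b`. -/
theorem IsGreedyChain.contains_of_insert {B V : Type*} [DecidableEq B] {g : B} {parent : B → B}
    {T : Finset B} {W : Finset (V × B)} {b : B} (hbg : b ≠ g)
    (hend : ∀ k ch, IsGreedyChain g parent T W k ch → ch k = parent b)
    {k : ℕ} {ch : ℕ → B} (h : IsGreedyChain g parent (insert b T) W k ch) :
    ∃ i ≤ k, ch i = b := by
  by_contra! hne
  obtain ⟨hstart, hmem, hchild, hleaf⟩ := h
  have hmemT : ∀ i ≤ k, ch i ∈ T := fun i hi =>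
    (Finset.mem_insert.1 (hmem i hi)).resolve_left (hne i hi)
  have hmono : ∀ {a c}, IsChild g parent T a c → IsChild g parent (insert b T) a c :=
    fun hc => ⟨Finset.mem_insert_of_mem hc.1, hc.2⟩
  have hk : ch k = parent b := hend k ch ⟨hstart, hmemT,
    fun i hi => ⟨⟨hmemT _ hi, (hchild i hi).1.2⟩, fun c hc => (hchild i hi).2 c (hmono hc)⟩,
    fun c hc => hleaf c (hmono hc)⟩
  exact hleaf b ⟨Finset.mem_insert_self b T, hbg, hk.symm⟩

/-- If all validators of `H` vote only for descendants of `b` and they outnumber those of `A`,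
then every greedy heaviest chain of `(T, W)` with `H ⊆ W ⊆ H ∪ A` contains `b`. -/
theorem IsGreedyChain.contains_of_majority {B V : Type*} [DecidableEq B] [DecidableEq V]
    {g : B} {parent : B → B} (hpg : parent g = g) (hanc : ∀ x, Ancestor parent g x)
    {T : Finset B} (hT : IsBlocktree g parent T) {b : B} (hb : b ∈ T)
    {H A W : Finset (V × B)} (hmaj : (A.image Prod.fst).card < (H.image Prod.fst).card)
    (hH : ∀ q ∈ H, Ancestor parent b q.2) (hHW : H ⊆ W) (hWHA : W ⊆ H ∪ A)
    {k : ℕ} {ch : ℕ → B} (h : IsGreedyChain g parent T W k ch) :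
    ∃ i ≤ k, ch i = b := by
  classical
  by_contra! hne
  have hanc_b : ∀ i ≤ k, Ancestor parent (ch i) b := by
    intro i
    induction i with
    | zero => exact fun _ => h.1 ▸ hanc b
    | succ i ih =>
      intro hi
      have hib := ih (by omega)
      obtain ⟨c, hc, hcb⟩ := hib.exists_isChild hpg hT hb (hne i (by omega))
      obtain ⟨hchild, hmax⟩ := h.2.2.1 i hi
      by_contra hnot
      have hlow : (H.image Prod.fst).card ≤ wt parent W c := by
        unfold wt
        convert Finset.card_le_card (Finset.image_subset_image (f := Prod.fst)
          (show H ⊆ W.filter (fun q => Ancestor parent c q.2) from fun q hq =>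
            Finset.mem_filter.2 ⟨hHW hq, hcb.trans (hH q hq)⟩))
      have hup : wt parent W (ch (i + 1)) ≤ (A.image Prod.fst).card := by
        unfold wt
        convert Finset.card_le_card (Finset.image_subset_image (f := Prod.fst)
          (show W.filter (fun q => Ancestor parent (ch (i + 1)) q.2) ⊆ A from fun q hq => ?_))
        obtain ⟨hqW, hq⟩ := Finset.mem_filter.1 hq
        refine (Finset.mem_union.1 (hWHA hqW)).resolve_left fun hqH => ?_
        have hbi := (hq.total_of_common (hH q hqH)).resolve_left hnot
        rcases hbi.eq_or_parent with heq | hbi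
        · exact hne (i + 1) hi heq.symm
        · rw [hchild.2.2] at hbi
          exact hne i (by omega) (Ancestor.antisymm hpg hanc hib hbi)
      have := hmax c hc
      omega
  obtain ⟨c, hc, -⟩ := (hanc_b k le_rfl).exists_isChild hpg hT hb (hne k le_rfl)
  exact h.2.2.2 c hc

/-- **Abstract reorg resilience.** Suppose every greedy heaviest
chain of `(T, Wstar)` ends at `p ∈ T`, and `b ∉ T` is a new block with
`parent b = p` receiving no votes in `Wstar`; let `T' = T ∪ {b}`. If in slot `0`
every honest vote is for the endpoint of some greedy heaviest chain of
`(T', Wstar)`, honest voters outnumber adversarial voters in each slot `s ≤ N`,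
and every honest slot-`s` vote (`1 ≤ s ≤ N`) is for the endpoint of a greedy
heaviest chain of `(T', W)` for some `W` with `H (s-1) ⊆ W ⊆ H (s-1) ∪ A (s-1)`,
then for every `s ≤ N` and every `W` with `H s ⊆ W ⊆ H s ∪ A s`, every greedy
heaviest chain of `(T', W)` contains `b`. -/
theorem abstract_reorg_resilience
    {B V : Type*} [DecidableEq B] [DecidableEq V]
    (g : B) (parent : B → B) (hpg : parent g = g) (hanc : ∀ x, Ancestor parent g x)
    (T : Finset B) (hT : IsBlocktree g parent T)
    (p : B) (hp : p ∈ T) (Wstar : Finset (V × B))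
    (hend : ∀ k ch, IsGreedyChain g parent T Wstar k ch → ch k = p)
    (b : B) (hbT : b ∉ T) (hbp : parent b = p)
    (hnovote : ∀ q ∈ Wstar, ¬ Ancestor parent b q.2)
    (N : ℕ) (H A : ℕ → Finset (V × B))
    (hdisj : ∀ s ≤ N, ∀ v : V, (∃ c, (v, c) ∈ H s) → ¬ ∃ c, (v, c) ∈ A s)
    (hmaj : ∀ s ≤ N, ((A s).image Prod.fst).card < ((H s).image Prod.fst).card)
    (h0 : ∀ q ∈ H 0, ∃ k ch,
      IsGreedyChain g parent (insert b T) Wstar k ch ∧ ch k = q.2)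
    (hstep : ∀ s, 1 ≤ s → s ≤ N → ∀ v c, (v, c) ∈ H s →
      ∃ W : Finset (V × B), H (s - 1) ⊆ W ∧ W ⊆ H (s - 1) ∪ A (s - 1) ∧
        ∃ k ch, IsGreedyChain g parent (insert b T) W k ch ∧ ch k = c) :
    ∀ s ≤ N, ∀ W : Finset (V × B), H s ⊆ W → W ⊆ H s ∪ A s →
      ∀ k ch, IsGreedyChain g parent (insert b T) W k ch → ∃ i ≤ k, ch i = b := by
  have hT' : IsBlocktree g parent (insert b T) := hT.insert (hbp ▸ hp)
  have hbT' : b ∈ insert b T := Finset.mem_insert_self b T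
  have hbg : b ≠ g := fun h => hbT (h ▸ hT.1)
  have hdesc : ∀ {W k ch}, IsGreedyChain (V := V) g parent (insert b T) W k ch →
      (∃ i ≤ k, ch i = b) → Ancestor parent b (ch k) := by
    rintro W k ch h ⟨i, hi, rfl⟩
    exact h.ancestor_endpoint hi
  intro s
  induction s with
  | zero =>
    intro hs W hHW hWHA k ch h
    refine h.contains_of_majority hpg hanc hT' hbT' (hmaj 0 hs) (fun q hq => ?_) hHW hWHA
    obtain ⟨k, ch, hch, hq⟩ := h0 q hq
    rw [← hq]
    exact hdesc hch (hch.contains_of_insert hbg (fun k ch h => (hend k ch h).trans hbp.symm))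
  | succ s ih =>
    intro hs W hHW hWHA k ch h
    refine h.contains_of_majority hpg hanc hT' hbT' (hmaj _ hs) (fun q hq => ?_) hHW hWHA
    obtain ⟨W, hHW, hWHA, k, ch, hch, hq⟩ := hstep (s + 1) (by omega) hs q.1 q.2 hq
    rw [← hq]
    exact hdesc hch (ih (by omega) W hHW hWHA k ch hch)
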